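/- arXiv:2409.17551 — 2 statements merged into one kernel-verified Lean document; each statement's English description precedes it below -/
import Mathlib

section
/- Let k be a field, let R and S be polynomial rings over k in at least one variable each, with graded maximal ideals m and n, let I ⊆ m² and J ⊆ n² be proper homogeneous ideals, let T = R ⊗_k S, and let F = I + J + mn ⊆ T. If depth(R/I) ≥ 1 and depth(S/J) ≥ 1, then for every integer s ≥ 1 one has F^{(s)} = Σ_{i=0}^{s} Σ_{t=0}^{s} (I^{(i)} ∩ m^{s-t})(J^{(t)} ∩ n^{s-i}). -/
/- STATEMENT 13: k a field, R and S polynomial rings over k in at least one variable each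
with graded maximal ideals m and n, I ⊆ m² and J ⊆ n² proper homogeneous ideals,
T = R ⊗_k S, F = I + J + mn. If depth(R/I) ≥ 1 and depth(S/J) ≥ 1, then for every s ≥ 1:
F^{(s)} = Σ_{i=0}^{s} Σ_{t=0}^{s} (I^{(i)} ∩ m^{s-t})(J^{(t)} ∩ n^{s-i}),
with the convention a^{(0)} = A. -/

open MvPolynomial

noncomputable section

/-- The graded maximal ideal of a polynomial ring, generated by the variables. -/
def mxI (k : Type*) [Field k] (σ : Type*) : Ideal (MvPolynomial σ k) :=
  Ideal.span (Set.range MvPolynomial.X)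

/-- An ideal of a polynomial ring is homogeneous if it contains every homogeneous
component of each of its elements. -/
def IsHomogIdeal {k : Type*} [Field k] {σ : Type*} (I : Ideal (MvPolynomial σ k)) : Prop :=
  ∀ f ∈ I, ∀ d : ℕ, MvPolynomial.homogeneousComponent d f ∈ I

/-- The `s`-th symbolic power of an ideal `a`: the intersection over all associated primes `P`
of `A ⧸ a` of the contraction of `a ^ s` extended to the localization at `P`. Note that
`symbPow a 0 = ⊤`, matching the convention `a^{(0)} = A`. -/
def symbPow {A : Type*} [CommRing A] (a : Ideal A) (s : ℕ) : Ideal A :=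
  sInf { J : Ideal A | ∃ (P : Ideal A) (hP : P ∈ associatedPrimes A (A ⧸ a)),
      haveI : P.IsPrime := IsAssociatedPrime.isPrime hP
      J = (Ideal.map (algebraMap A (Localization.AtPrime P)) (a ^ s)).comap
            (algebraMap A (Localization.AtPrime P)) }

theorem mem_associatedPrimes_quotient_iff {A : Type*} [CommRing A] [IsNoetherianRing A]
    {a P : Ideal A} :
    P ∈ associatedPrimes A (A ⧸ a) ↔ P.IsPrime ∧ ∃ x, ∀ y, y ∈ P ↔ y * x ∈ a := by
  rw [AssociatedPrimes.mem_iff, IsAssociatedPrime, Submodule.isAssociatedPrime_iff]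
  refine and_congr_right fun _ => ⟨?_, ?_⟩
  · rintro ⟨x, rfl⟩
    obtain ⟨x, rfl⟩ := Ideal.Quotient.mk_surjective x
    refine ⟨x, fun y => ?_⟩
    rw [Submodule.mem_colon_singleton, Submodule.mem_bot, ← Ideal.Quotient.eq_zero_iff_mem,
      map_mul]
    rfl
  · rintro ⟨x, hx⟩
    refine ⟨Ideal.Quotient.mk a x, ?_⟩
    ext y
    rw [hx, Submodule.mem_colon_singleton, Submodule.mem_bot, ← Ideal.Quotient.eq_zero_iff_mem,
      map_mul]
    rfl

/-- The contraction to `A` of the extension of `a` to the localization at `P`. -/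
def contraction {A : Type*} [CommRing A] (P : Ideal A) [P.IsPrime] (a : Ideal A) : Ideal A :=
  (a.map (algebraMap A (Localization.AtPrime P))).comap (algebraMap A (Localization.AtPrime P))

theorem mem_contraction {A : Type*} [CommRing A] {P : Ideal A} [P.IsPrime] {a : Ideal A} {f : A} :
    f ∈ contraction P a ↔ ∃ u ∉ P, u * f ∈ a := by
  rw [contraction, Ideal.mem_comap,
    IsLocalization.algebraMap_mem_map_algebraMap_iff P.primeCompl]
  rfl

theorem mem_symbPow {A : Type*} [CommRing A] {a : Ideal A} {s : ℕ} {f : A} :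
    f ∈ symbPow a s ↔ ∀ P ∈ associatedPrimes A (A ⧸ a), ∃ u ∉ P, u * f ∈ a ^ s := by
  rw [symbPow, Submodule.mem_sInf]
  constructor
  · intro h P hP
    have : P.IsPrime := IsAssociatedPrime.isPrime hP
    exact mem_contraction.1 (h _ ⟨P, hP, rfl⟩)
  · rintro h _ ⟨P, hP, rfl⟩
    have : P.IsPrime := IsAssociatedPrime.isPrime hP
    exact mem_contraction.2 (h P hP)

/-- A polynomial some of whose coefficients is a unit is not a zero divisor. -/
theorem Polynomial.eq_zero_of_mul_eq_zero_of_isUnit_coeff {A : Type*} [CommRing A]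
    {u f : Polynomial A} {d : ℕ} (hu : IsUnit (u.coeff d)) (h : u * f = 0) : f = 0 := by
  have hreg : u ∈ nonZeroDivisors (Polynomial A) := by
    refine Polynomial.mem_nonZeroDivisors_iff.2 fun c hc => ?_
    have := congrArg (fun p => Polynomial.coeff p d) hc
    simpa [hu.mul_left_eq_zero] using this
  exact (mul_left_mem_nonZeroDivisors_eq_zero_iff hreg).1 h

section Homogeneous

variable {k : Type*} [Field k] {σ : Type*}

/-- The map `f ↦ ∑ d, f_d t ^ d` recording the homogeneous components of a polynomial. -/
def homogeneousExpansion (k : Type*) [Field k] (σ : Type*) :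
    MvPolynomial σ k →ₐ[k] Polynomial (MvPolynomial σ k) :=
  aeval fun i => Polynomial.C (X i) * Polynomial.X

theorem coeff_homogeneousExpansion (f : MvPolynomial σ k) (d : ℕ) :
    (homogeneousExpansion k σ f).coeff d = homogeneousComponent d f := by
  induction f using MvPolynomial.induction_on' with
  | monomial α c =>
    have h : homogeneousExpansion k σ (monomial α c)
        = Polynomial.C (monomial α c) * Polynomial.X ^ α.degree := by
      rw [homogeneousExpansion, aeval_monomial, monomial_eq, Finsupp.degree_apply]
      simp only [mul_pow, Finsupp.prod, Finset.prod_mul_distrib, Finset.prod_pow_eq_pow_sum,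
        map_mul, map_prod, map_pow]
      rw [mul_assoc]
      rfl
    rw [h, Polynomial.coeff_C_mul_X_pow]
    ext β
    rw [coeff_homogeneousComponent]
    by_cases hβ : α = β
    · subst hβ
      by_cases h : d = α.degree <;> simp [h, eq_comm]
    · have hz : coeff β (monomial α c) = 0 := by
        classical rw [coeff_monomial, if_neg hβ]
      by_cases h : d = α.degree <;> simp [h, hz]
  | add p q hp hq => simp [hp, hq]

theorem IsHomogIdeal.pow {I : Ideal (MvPolynomial σ k)} (hI : IsHomogIdeal I) (s : ℕ) :
    IsHomogIdeal (I ^ s) := by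
  have h : I ≤ (I.map Polynomial.C).comap (homogeneousExpansion k σ) := fun f hf =>
    Ideal.mem_map_C_iff.2 fun d => by
      rw [coeff_homogeneousExpansion]
      exact hI f hf d
  intro f hf d
  have := (Ideal.pow_right_mono h s).trans (Ideal.le_comap_pow _ s) hf
  rw [Ideal.mem_comap, ← Ideal.map_pow, Ideal.mem_map_C_iff] at this
  rw [← coeff_homogeneousExpansion]
  exact this d

theorem map_homogeneousComponent_eq_zero {B : Type*} [CommRing B] (φ : MvPolynomial σ k →+* B)
    {u f : MvPolynomial σ k} {e : ℕ} (hu : IsUnit (φ (homogeneousComponent e u)))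
    (huf : ∀ n, φ (homogeneousComponent n (u * f)) = 0) (d : ℕ) :
    φ (homogeneousComponent d f) = 0 := by
  have hψ : ∀ g e, ((homogeneousExpansion k σ g).map φ).coeff e = φ (homogeneousComponent e g) :=
    fun g e => by rw [Polynomial.coeff_map, coeff_homogeneousExpansion]
  have hmul : (homogeneousExpansion k σ u).map φ * (homogeneousExpansion k σ f).map φ = 0 := by
    rw [← Polynomial.map_mul, ← map_mul]
    ext n
    rw [hψ, huf, Polynomial.coeff_zero]
  rw [← hψ] at hu ⊢
  rw [Polynomial.eq_zero_of_mul_eq_zero_of_isUnit_coeff hu hmul, Polynomial.coeff_zero]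

theorem IsHomogIdeal.contraction {I : Ideal (MvPolynomial σ k)} (hI : IsHomogIdeal I)
    (P : Ideal (MvPolynomial σ k)) [P.IsPrime] : IsHomogIdeal (contraction P I) := by
  intro f hf d
  obtain ⟨u, hu, huf⟩ := mem_contraction.1 hf
  obtain ⟨e, he⟩ : ∃ e, homogeneousComponent e u ∉ P := by
    by_contra! h
    refine hu ?_
    rw [← sum_homogeneousComponent u]
    exact Ideal.sum_mem _ fun i _ => h i
  rw [_root_.contraction, Ideal.mem_comap, ← Ideal.Quotient.eq_zero_iff_mem]
  refine map_homogeneousComponent_eq_zero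
    (B := Localization.AtPrime P ⧸ I.map (algebraMap _ (Localization.AtPrime P)))
    ((Ideal.Quotient.mk _).comp (algebraMap _ (Localization.AtPrime P))) (e := e) (u := u)
    ?_ (fun n => ?_) d
  · exact (IsLocalization.map_units _ (⟨_, he⟩ : P.primeCompl)).map (Ideal.Quotient.mk _)
  · exact Ideal.Quotient.eq_zero_iff_mem.2 (Ideal.mem_map_of_mem _ (hI _ huf n))

theorem IsHomogIdeal.symbPow {I : Ideal (MvPolynomial σ k)} (hI : IsHomogIdeal I) (s : ℕ) :
    IsHomogIdeal (symbPow I s) := by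
  intro f hf d
  rw [mem_symbPow] at hf ⊢
  intro P hP
  have : P.IsPrime := IsAssociatedPrime.isPrime hP
  exact mem_contraction.1 ((hI.pow s).contraction P f (mem_contraction.2 (hf P hP)) d)

end Homogeneous

section Retract

variable {R T : Type*} [CommRing R] [CommRing T] {ι : R →+* T} {π : T →+* R} {I m : Ideal R}
  {F N : Ideal T}

theorem mul_sub_mem_of_sub_mem (hN : ∀ h, h - ι (π h) ∈ N) (hmN : m.map ι * N ≤ F)
    {x : R} (hx : x ∈ m) (h : T) : ι x * h - ι (x * π h) ∈ F := by
  rw [map_mul, ← mul_sub]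
  exact hmN (Ideal.mul_mem_mul (Ideal.mem_map_of_mem _ hx) (hN h))

theorem comap_mem_associatedPrimes [IsNoetherianRing R] [IsNoetherianRing T]
    (hπι : ∀ r, π (ι r) = r) (hN : ∀ h, h - ι (π h) ∈ N) (hmN : m.map ι * N ≤ F)
    (hIF : I.map ι ≤ F) (hFI : F ≤ I.comap π)
    {P : Ideal R} (hP : P ∈ associatedPrimes R (R ⧸ I)) (hmP : ¬ m ≤ P) :
    P.comap π ∈ associatedPrimes T (T ⧸ F) := by
  rw [mem_associatedPrimes_quotient_iff] at hP ⊢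
  obtain ⟨hP, g, hg⟩ := hP
  obtain ⟨x, hxm, hxP⟩ := SetLike.not_le_iff_exists.1 hmP
  refine ⟨hP.comap π, ι (x * g), fun h => ?_⟩
  rw [Ideal.mem_comap]
  constructor
  · intro hh
    have h1 := Ideal.mul_mem_right (ι g) F (mul_sub_mem_of_sub_mem hN hmN hxm h)
    have h2 : ι (x * (π h * g)) ∈ F :=
      hIF (Ideal.mem_map_of_mem _ (Ideal.mul_mem_left _ _ ((hg _).1 hh)))
    convert Ideal.add_mem _ h1 h2 using 1
    simp only [map_mul]
    ring
  · intro hh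
    have h1 : π h * (x * g) ∈ I := by simpa [hπι] using hFI hh
    refine (hP.mem_or_mem ((hg (π h * x)).2 ?_)).resolve_right hxP
    rwa [mul_assoc]

theorem exists_eq_comap_of_mem_associatedPrimes [IsNoetherianRing R] [IsNoetherianRing T]
    (hπι : ∀ r, π (ι r) = r) (hN : ∀ h, h - ι (π h) ∈ N) (hmN : m.map ι * N ≤ F)
    (hIF : I.map ι ≤ F) (hFI : F ≤ I.comap π)
    {Q : Ideal T} (hQ : Q ∈ associatedPrimes T (T ⧸ F)) (hNQ : N ≤ Q) (hmQ : ¬ m.map ι ≤ Q) :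
    ∃ P ∈ associatedPrimes R (R ⧸ I), Q = P.comap π ∧ ¬ m ≤ P := by
  rw [mem_associatedPrimes_quotient_iff] at hQ
  obtain ⟨hQ, g, hg⟩ := hQ
  rw [Ideal.map_le_iff_le_comap] at hmQ
  obtain ⟨x, hxm, hxQ⟩ := SetLike.not_le_iff_exists.1 hmQ
  refine ⟨Q.comap ι, mem_associatedPrimes_quotient_iff.2 ⟨hQ.comap ι, x * π g, fun y => ?_⟩,
    ?_, hmQ⟩
  · have h1 := Ideal.mul_mem_left _ (ι y) (mul_sub_mem_of_sub_mem hN hmN hxm g)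
    rw [mul_sub, ← map_mul] at h1
    have h2 : y * (x * π g) ∈ I ↔ ι (y * (x * π g)) ∈ F :=
      ⟨fun h => hIF (Ideal.mem_map_of_mem _ h), fun h => by simpa [hπι] using hFI h⟩
    have h3 : ι y * (ι x * g) ∈ F ↔ ι (y * (x * π g)) ∈ F :=
      ⟨fun h => by simpa using Ideal.sub_mem _ h h1, fun h => by simpa using Ideal.add_mem _ h1 h⟩
    rw [h2, ← h3, ← mul_assoc, ← hg]
    exact ⟨fun h => Ideal.mul_mem_right _ _ h, fun h => (hQ.mem_or_mem h).resolve_right hxQ⟩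
  · ext h
    rw [Ideal.mem_comap, Ideal.mem_comap]
    exact ⟨fun hh => by simpa using Ideal.sub_mem _ hh (hNQ (hN h)),
      fun hh => by simpa using Ideal.add_mem _ (hNQ (hN h)) hh⟩

theorem map_symbPow_mul_pow_le_contraction
    (hπι : ∀ r, π (ι r) = r) (hmN : m.map ι * N ≤ F) (hIF : I.map ι ≤ F)
    {P : Ideal R} (hP : P ∈ associatedPrimes R (R ⧸ I)) (hmP : ¬ m ≤ P) [(P.comap π).IsPrime]
    {i j s : ℕ} (hs : s ≤ i + j) :
    (symbPow I i).map ι * N ^ j ≤ contraction (P.comap π) (F ^ s) := by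
  have hPp : P.IsPrime := IsAssociatedPrime.isPrime hP
  obtain ⟨x, hxm, hxP⟩ := SetLike.not_le_iff_exists.1 hmP
  have h1 : (symbPow I i).map ι ≤ contraction (P.comap π) (I.map ι ^ i) := by
    refine Ideal.map_le_iff_le_comap.2 fun f hf => ?_
    obtain ⟨u, hu, huf⟩ := mem_symbPow.1 hf P hP
    refine mem_contraction.2 ⟨ι u, by simpa [hπι] using hu, ?_⟩
    rw [← map_mul, ← Ideal.map_pow]
    exact Ideal.mem_map_of_mem _ huf
  refine Ideal.mul_le.2 fun f hf g hg => ?_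
  obtain ⟨u, hu, huf⟩ := mem_contraction.1 (h1 hf)
  refine mem_contraction.2 ⟨u * ι (x ^ j), fun h => ?_, ?_⟩
  · rcases Ideal.IsPrime.mem_or_mem inferInstance h with h | h
    · exact hu h
    · exact hxP (hPp.mem_of_pow_mem j (by simpa [hπι] using h))
  · refine Ideal.pow_le_pow_right hs ?_
    have h2 : ι (x ^ j) * g ∈ F ^ j := by
      refine Ideal.pow_right_mono hmN j ?_
      rw [mul_pow, map_pow]
      exact Ideal.mul_mem_mul (Ideal.pow_mem_pow (Ideal.mem_map_of_mem _ hxm) j) hg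
    rw [pow_add]
    convert Ideal.mul_mem_mul (Ideal.pow_right_mono hIF i huf) h2 using 1
    ring

theorem apply_mem_of_forall_mul_mem [IsNoetherianRing R] (hπι : ∀ r, π (ι r) = r)
    (hFI : F ≤ I.comap π) (hm : m.IsMaximal) (hmI : m ∉ associatedPrimes R (R ⧸ I)) {h : T}
    (hh : ∀ y ∈ m.map ι, y * h ∈ F) : π h ∈ I := by
  by_contra hI
  have hle : m ≤ I.colon {π h} := fun y hy =>
    Submodule.mem_colon_singleton.2
      (by simpa [hπι] using hFI (hh _ (Ideal.mem_map_of_mem ι hy)))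
  have hne : I.colon {π h} ≠ ⊤ := fun htop => hI <| by
    simpa using Submodule.mem_colon_singleton.1 ((Ideal.eq_top_iff_one _).1 htop)
  refine hmI (mem_associatedPrimes_quotient_iff.2 ⟨hm.isPrime, π h, fun y => ?_⟩)
  rw [hm.eq_of_le hne hle, Submodule.mem_colon_singleton, smul_eq_mul]

end Retract

section Coefficients

variable {R τ : Type*} [CommRing R]

theorem coeff_mem_pow_of_mem_pow (I : Ideal R) {s : ℕ} {f : MvPolynomial τ R}
    (hf : f ∈ (I.map C ⊔ Ideal.span (Set.range (X : τ → MvPolynomial τ R))) ^ s)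
    (β : τ →₀ ℕ) : coeff β f ∈ I ^ (s - β.degree) := by
  classical
  induction s generalizing f β with
  | zero => simp
  | succ s ih =>
    rw [pow_succ] at hf
    refine Submodule.mul_induction_on hf (fun p hp q hq => ?_) (fun p q hp hq => ?_)
    · rw [coeff_mul]
      refine Ideal.sum_mem _ fun ⟨γ, δ⟩ hγδ => ?_
      have hdeg : γ.degree + δ.degree = β.degree := by
        rw [← Finset.HasAntidiagonal.mem_antidiagonal.1 hγδ, map_add]
      by_cases hδ : δ = 0
      · subst hδ
        have hq0 : coeff 0 q ∈ I := by
          obtain ⟨a, ha, b, hb, rfl⟩ := Submodule.mem_sup.1 hq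
          have hb0 : coeff 0 b = 0 := by
            have : Ideal.span (Set.range (X : τ → MvPolynomial τ R)) ≤
                RingHom.ker (constantCoeff (σ := τ) (R := R)) := by
              rw [Ideal.span_le]
              rintro _ ⟨i, rfl⟩
              simp
            exact this hb
          rw [coeff_add, hb0, add_zero]
          exact mem_map_C_iff.1 ha 0
        have h3 := Ideal.mul_mem_mul (ih hp γ) hq0
        rw [← pow_succ] at h3
        refine Ideal.pow_le_pow_right ?_ h3
        simp at hdeg
        omega
      · have : 0 < δ.degree := by
          rw [pos_iff_ne_zero, ne_eq, Finsupp.degree_eq_zero_iff]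
          exact hδ
        exact Ideal.mul_mem_right _ _ (Ideal.pow_le_pow_right (by omega) (ih hp γ))
    · rw [coeff_add]
      exact Ideal.add_mem _ hp hq

theorem coeff_mem_of_mul_coeff_mem {Q : ℕ → Ideal R} (hQ : Antitone Q) {u f : MvPolynomial τ R}
    (hu : ∀ n r, constantCoeff u * r ∈ Q n → r ∈ Q n) {s : ℕ}
    (huf : ∀ β : τ →₀ ℕ, coeff β (u * f) ∈ Q (s - β.degree)) (β : τ →₀ ℕ) :
    coeff β f ∈ Q (s - β.degree) := by
  classical
  induction hn : β.degree using Nat.strong_induction_on generalizing β with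
  | _ n ih =>
  subst hn
  have h := huf β
  have h0 : ((0 : τ →₀ ℕ), β) ∈ Finset.HasAntidiagonal.antidiagonal β := by simp
  rw [coeff_mul, ← Finset.add_sum_erase _ _ h0] at h
  refine hu _ _ ((Ideal.add_mem_iff_left _ (Ideal.sum_mem _ fun ⟨γ, δ⟩ hγδ => ?_)).1 h)
  obtain ⟨hne, hγδ⟩ := Finset.mem_erase.1 hγδ
  have hsum := Finset.HasAntidiagonal.mem_antidiagonal.1 hγδ
  have hdeg : γ.degree + δ.degree = β.degree := by rw [← hsum, map_add]
  have hγ : 0 < γ.degree := by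
    rw [pos_iff_ne_zero, ne_eq, Finsupp.degree_eq_zero_iff]
    rintro rfl
    simp at hsum
    exact hne (by rw [hsum])
  exact Ideal.mul_mem_left _ _ (hQ (by omega) (ih δ.degree (by omega) δ rfl))

theorem coeff_mem_contraction {I P : Ideal R} [P.IsPrime] {u f : MvPolynomial τ R}
    (hu : constantCoeff u ∉ P) {s : ℕ}
    (huf : u * f ∈ (I.map C ⊔ Ideal.span (Set.range (X : τ → MvPolynomial τ R))) ^ s)
    (β : τ →₀ ℕ) : coeff β f ∈ contraction P (I ^ (s - β.degree)) := by
  refine coeff_mem_of_mul_coeff_mem (u := u) (Q := fun n => contraction P (I ^ n)) (fun i j hij => ?_)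
    (fun n r hr => ?_) (fun γ => ?_) β
  · exact Ideal.comap_mono (Ideal.map_mono (Ideal.pow_le_pow_right hij))
  · obtain ⟨v, hv, hvr⟩ := mem_contraction.1 hr
    refine mem_contraction.2 ⟨v * constantCoeff u, fun h => ?_, by rwa [mul_assoc]⟩
    exact (Ideal.IsPrime.mem_or_mem inferInstance h).elim hv hu
  · exact mem_contraction.2 ⟨1, (Ideal.ne_top_iff_one P).1 Ideal.IsPrime.ne_top',
      by simpa using coeff_mem_pow_of_mem_pow I huf γ⟩

end Coefficients

section Retract

variable {R T τ : Type*} [CommRing R] [CommRing T] {ι : R →+* T} {I m : Ideal R} {F N : Ideal T}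
  {Φ : T →+* MvPolynomial τ R}

theorem le_comap_constantCoeff_comp
    (hF : F ≤ (I.map C ⊔ Ideal.span (Set.range X)).comap Φ) :
    F ≤ I.comap (constantCoeff.comp Φ) := by
  intro f hf
  have := coeff_mem_pow_of_mem_pow I (s := 1) (by simpa using hF hf) 0
  simpa [constantCoeff_eq] using this

theorem coeff_mem_symbPow_of_mem_symbPow [IsNoetherianRing R] [IsNoetherianRing T]
    (hΦι : ∀ r, Φ (ι r) = C r) (hN : ∀ h, h - ι (constantCoeff (Φ h)) ∈ N)
    (hmN : m.map ι * N ≤ F) (hIF : I.map ι ≤ F)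
    (hF : F ≤ (I.map C ⊔ Ideal.span (Set.range X)).comap Φ)
    (hm : m.IsMaximal) (hmI : m ∉ associatedPrimes R (R ⧸ I))
    {f : T} {s : ℕ} (hf : f ∈ symbPow F s) (β : τ →₀ ℕ) :
    coeff β (Φ f) ∈ symbPow I (s - β.degree) := by
  refine mem_symbPow.2 fun P hP => ?_
  have hPp : P.IsPrime := IsAssociatedPrime.isPrime hP
  have hmP : ¬ m ≤ P := fun h => hmI (by rwa [hm.eq_of_le hPp.ne_top h])
  obtain ⟨u, hu, huf⟩ := mem_symbPow.1 hf _ (comap_mem_associatedPrimes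
    (π := constantCoeff.comp Φ) (by simp [hΦι]) hN hmN hIF (le_comap_constantCoeff_comp hF) hP hmP)
  refine mem_contraction.1 (coeff_mem_contraction (u := Φ u) hu ?_ β)
  rw [← map_mul]
  exact Ideal.le_comap_pow Φ s (Ideal.pow_right_mono hF s huf)

end Retract

section FiberProduct

variable {k : Type*} [Field k] {σ τ : Type*}

theorem mxI_eq_idealOfVars : mxI k σ = idealOfVars σ k := rfl

theorem mxI_eq_ker : mxI k σ = RingHom.ker (constantCoeff (σ := σ) (R := k)) := by
  rw [mxI_eq_idealOfVars]
  ext f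
  have := mem_pow_idealOfVars_iff (σ := σ) (R := k) 1 f
  rw [pow_one] at this
  rw [this, RingHom.mem_ker, constantCoeff_eq]
  constructor
  · intro h
    by_contra h0
    simpa using h 0 (mem_support_iff.2 h0)
  · intro h x hx
    rw [Nat.one_le_iff_ne_zero, ne_eq, Finsupp.degree_eq_zero_iff]
    rintro rfl
    exact mem_support_iff.1 hx h

theorem isMaximal_mxI : (mxI k σ).IsMaximal := by
  rw [mxI_eq_ker]
  exact RingHom.ker_isMaximal_of_surjective _ fun c => ⟨C c, by simp⟩

theorem mem_mxI_pow_of_isHomogeneous {f : MvPolynomial σ k} {d : ℕ} (hf : f.IsHomogeneous d) :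
    f ∈ mxI k σ ^ d := by
  rw [mxI_eq_idealOfVars, mem_pow_idealOfVars_iff]
  intro x hx
  rw [Finsupp.degree_eq_weight_one]
  exact (hf (mem_support_iff.1 hx)).ge

/-- The polynomial ring in two sets of variables, as polynomials in the second set with
coefficients in the polynomial ring in the first set. -/
def rowHom (k : Type*) [Field k] (σ τ : Type*) :
    MvPolynomial (σ ⊕ τ) k →ₐ[k] MvPolynomial τ (MvPolynomial σ k) :=
  aeval (Sum.elim (fun i => C (X i)) X)

/-- The polynomial ring in two sets of variables, as polynomials in the first set with
coefficients in the polynomial ring in the second set. -/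
def colHom (k : Type*) [Field k] (σ τ : Type*) :
    MvPolynomial (σ ⊕ τ) k →ₐ[k] MvPolynomial σ (MvPolynomial τ k) :=
  aeval (Sum.elim X (fun j => C (X j)))

theorem rowHom_rename_inl (f : MvPolynomial σ k) : rowHom k σ τ (rename Sum.inl f) = C f := by
  have : (rowHom k σ τ).comp (rename Sum.inl) =
      (Algebra.ofId (MvPolynomial σ k) (MvPolynomial τ (MvPolynomial σ k))).restrictScalars k := by
    ext i : 1
    simp [rowHom, Algebra.ofId_apply, algebraMap_eq]
  exact DFunLike.congr_fun this f

theorem rowHom_rename_inr (f : MvPolynomial τ k) : rowHom k σ τ (rename Sum.inr f) = map C f := by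
  have : (rowHom k σ τ).comp (rename Sum.inr) = mapAlgHom (Algebra.ofId k (MvPolynomial σ k)) := by
    ext i : 1
    simp [rowHom]
  exact DFunLike.congr_fun this f

theorem colHom_rename_inr (f : MvPolynomial τ k) : colHom k σ τ (rename Sum.inr f) = C f := by
  have : (colHom k σ τ).comp (rename Sum.inr) =
      (Algebra.ofId (MvPolynomial τ k) (MvPolynomial σ (MvPolynomial τ k))).restrictScalars k := by
    ext i : 1
    simp [colHom, Algebra.ofId_apply, algebraMap_eq]
  exact DFunLike.congr_fun this f

theorem colHom_rename_inl (f : MvPolynomial σ k) : colHom k σ τ (rename Sum.inl f) = map C f := by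
  have : (colHom k σ τ).comp (rename Sum.inl) = mapAlgHom (Algebra.ofId k (MvPolynomial τ k)) := by
    ext i : 1
    simp [colHom]
  exact DFunLike.congr_fun this f

theorem sum_coeff_rowHom_mul (f : MvPolynomial (σ ⊕ τ) k) :
    f = ∑ β ∈ (rowHom k σ τ f).support,
      rename Sum.inl (coeff β (rowHom k σ τ f)) * rename Sum.inr (monomial β (1 : k)) := by
  let e : MvPolynomial τ (MvPolynomial σ k) →+* MvPolynomial (σ ⊕ τ) k :=
    eval₂Hom (rename Sum.inl : MvPolynomial σ k →ₐ[k] MvPolynomial (σ ⊕ τ) k).toRingHom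
      (fun j => X (Sum.inr j))
  have h : e.comp (rowHom k σ τ).toRingHom = RingHom.id _ := by
    refine MvPolynomial.ringHom_ext (fun c => ?_) ?_
    · have : (C c : MvPolynomial (σ ⊕ τ) k) = rename Sum.inl (C c : MvPolynomial σ k) := by simp
      rw [this]
      simp only [RingHom.comp_apply, AlgHom.toRingHom_eq_coe, RingHom.coe_coe, rowHom_rename_inl]
      simp [e]
    · rintro (i | j) <;> simp [e, rowHom]
  have hf : e (rowHom k σ τ f) = f := DFunLike.congr_fun h f
  conv_lhs => rw [← hf]
  rw [coe_eval₂Hom, eval₂_eq]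
  refine Finset.sum_congr rfl fun β _ => ?_
  rw [rename_monomial, monomial_eq, Finsupp.prod_mapDomain_index_inj Sum.inr_injective]
  simp [Finsupp.prod]

theorem coeff_coeff_rowHom (f : MvPolynomial (σ ⊕ τ) k) (α : σ →₀ ℕ) (β : τ →₀ ℕ) :
    coeff α (coeff β (rowHom k σ τ f)) = coeff β (coeff α (colHom k σ τ f)) := by
  rw [sum_coeff_rowHom_mul f]
  simp only [map_sum, coeff_sum, map_mul, rowHom_rename_inl, rowHom_rename_inr, colHom_rename_inl,
    colHom_rename_inr]
  refine Finset.sum_congr rfl fun γ _ => ?_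
  rw [coeff_C_mul, coeff_map, mul_comm, coeff_C_mul, mul_comm (map C _), coeff_C_mul, coeff_map,
    mul_comm (monomial _ _) (C _), coeff_C_mul, mul_comm]

theorem sub_rename_inl_mem (h : MvPolynomial (σ ⊕ τ) k) :
    h - rename Sum.inl (constantCoeff (rowHom k σ τ h)) ∈
      (mxI k τ).map (rename Sum.inr : MvPolynomial τ k →ₐ[k] MvPolynomial (σ ⊕ τ) k) := by
  rw [← Ideal.Quotient.mk_eq_mk_iff_sub_mem]
  set N := (mxI k τ).map (rename Sum.inr : MvPolynomial τ k →ₐ[k] MvPolynomial (σ ⊕ τ) k)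
  have : ((Ideal.Quotient.mk N).comp ((rename Sum.inl).toRingHom.comp
      ((constantCoeff (R := MvPolynomial σ k)).comp (rowHom k σ τ).toRingHom))) =
      Ideal.Quotient.mk N := by
    refine MvPolynomial.ringHom_ext (fun c => ?_) ?_
    · simp [algebraMap_eq]
    · rintro (i | j)
      · simp [rowHom]
      · have : Ideal.Quotient.mk N (X (Sum.inr j)) = 0 := Ideal.Quotient.eq_zero_iff_mem.2 <| by
          rw [← rename_X]
          exact Ideal.mem_map_of_mem _ (Ideal.subset_span ⟨j, rfl⟩)
        simp [rowHom, this]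
  exact (DFunLike.congr_fun this h).symm

theorem sub_rename_inr_mem (h : MvPolynomial (σ ⊕ τ) k) :
    h - rename Sum.inr (constantCoeff (colHom k σ τ h)) ∈
      (mxI k σ).map (rename Sum.inl : MvPolynomial σ k →ₐ[k] MvPolynomial (σ ⊕ τ) k) := by
  rw [← Ideal.Quotient.mk_eq_mk_iff_sub_mem]
  set M := (mxI k σ).map (rename Sum.inl : MvPolynomial σ k →ₐ[k] MvPolynomial (σ ⊕ τ) k)
  have : ((Ideal.Quotient.mk M).comp ((rename Sum.inr).toRingHom.comp
      ((constantCoeff (R := MvPolynomial τ k)).comp (colHom k σ τ).toRingHom))) =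
      Ideal.Quotient.mk M := by
    refine MvPolynomial.ringHom_ext (fun c => ?_) ?_
    · simp [algebraMap_eq]
    · rintro (i | j)
      · have : Ideal.Quotient.mk M (X (Sum.inl i)) = 0 := Ideal.Quotient.eq_zero_iff_mem.2 <| by
          rw [← rename_X]
          exact Ideal.mem_map_of_mem _ (Ideal.subset_span ⟨i, rfl⟩)
        simp [colHom, this]
      · simp [colHom]
  exact (DFunLike.congr_fun this h).symm

/-- A homogeneous ideal has a degree-preserving linear projection onto it. -/
theorem IsHomogIdeal.exists_projection {V : Ideal (MvPolynomial σ k)} (hV : IsHomogIdeal V) :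
    ∃ p : MvPolynomial σ k →ₗ[k] MvPolynomial σ k, (∀ v ∈ V, p v = v) ∧
      ∀ α, p (monomial α 1) ∈ V ∧ (p (monomial α 1)).IsHomogeneous α.degree := by
  let U : ℕ → Submodule k (MvPolynomial σ k) := fun d =>
    V.restrictScalars k ⊓ homogeneousSubmodule σ k d
  have hq : ∀ d, ∃ q : MvPolynomial σ k →ₗ[k] U d, q ∘ₗ (U d).subtype = LinearMap.id := fun d =>
    LinearMap.exists_leftInverse_of_injective _ (Submodule.ker_subtype _)
  choose q hq using hq
  let p := (basisMonomials σ k).constr k fun α => (q α.degree (monomial α 1) : MvPolynomial σ k)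
  have hp : ∀ α, p (monomial α 1) = q α.degree (monomial α 1) := fun α => by
    have := (basisMonomials σ k).constr_basis k
      (fun α => (q α.degree (monomial α 1) : MvPolynomial σ k)) α
    rwa [coe_basisMonomials] at this
  have hpq : ∀ d v, v.IsHomogeneous d → p v = q d v := fun d v hv => by
    rw [← support_sum_monomial_coeff v]
    simp only [map_sum, AddSubmonoidClass.coe_finsetSum]
    refine Finset.sum_congr rfl fun α hα => ?_
    have hd : α.degree = d := by
      rw [Finsupp.degree_eq_weight_one]
      exact hv (mem_support_iff.1 hα)
    rw [← mul_one (coeff α v), ← smul_eq_mul, ← smul_monomial, map_smul, map_smul, hp, hd]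
    rfl
  refine ⟨p, fun v hv => ?_, fun α => ?_⟩
  · conv_rhs => rw [← sum_homogeneousComponent v]
    conv_lhs => rw [← sum_homogeneousComponent v]
    rw [map_sum]
    refine Finset.sum_congr rfl fun d _ => ?_
    rw [hpq d _ (homogeneousComponent_isHomogeneous d v)]
    have := DFunLike.congr_fun (hq d) ⟨homogeneousComponent d v, hV v hv d,
      homogeneousComponent_mem d v⟩
    exact congrArg Subtype.val this
  · rw [hp]
    exact (q α.degree (monomial α 1)).2


theorem sum_monomial_degree_eq (f : MvPolynomial (σ ⊕ τ) k) (α : σ →₀ ℕ) (d : ℕ) :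
    ∑ β ∈ (rowHom k σ τ f).support with β.degree = d,
      monomial β (coeff α (coeff β (rowHom k σ τ f))) =
    homogeneousComponent d (coeff α (colHom k σ τ f)) := by
  classical
  ext γ
  rw [coeff_homogeneousComponent, coeff_sum]
  simp only [coeff_monomial]
  rw [Finset.sum_ite_eq', ← coeff_coeff_rowHom]
  by_cases hγ : γ ∈ (rowHom k σ τ f).support
  · simp only [Finset.mem_filter, hγ, true_and]
  · rw [notMem_support_iff.1 hγ, coeff_zero, ite_self, ite_self]

theorem sum_monomial_coeff_rowHom (f : MvPolynomial (σ ⊕ τ) k) (β : τ →₀ ℕ) :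
    ∑ α ∈ (colHom k σ τ f).support, monomial α (coeff α (coeff β (rowHom k σ τ f))) =
      coeff β (rowHom k σ τ f) := by
  classical
  ext γ
  rw [coeff_sum]
  simp only [coeff_monomial]
  rw [Finset.sum_ite_eq']
  split_ifs with hγ
  · rfl
  · rw [coeff_coeff_rowHom, notMem_support_iff.1 hγ, coeff_zero]

theorem eq_sum_projection_mul (p : ℕ → MvPolynomial σ k →ₗ[k] MvPolynomial σ k)
    {f : MvPolynomial (σ ⊕ τ) k}
    (hp : ∀ β, p β.degree (coeff β (rowHom k σ τ f)) = coeff β (rowHom k σ τ f)) :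
    f = ∑ α ∈ (colHom k σ τ f).support,
      ∑ d ∈ (rowHom k σ τ f).support.image Finsupp.degree,
        rename Sum.inl (p d (monomial α 1)) *
          rename Sum.inr (homogeneousComponent d (coeff α (colHom k σ τ f))) := by
  classical
  set B := (rowHom k σ τ f).support with hB
  have h1 : ∀ β, coeff β (rowHom k σ τ f) = ∑ α ∈ (colHom k σ τ f).support,
      coeff α (coeff β (rowHom k σ τ f)) • p β.degree (monomial α 1) := fun β => by
    have h := DFunLike.congr_arg (p β.degree) (sum_monomial_coeff_rowHom f β)
    rw [hp, map_sum] at h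
    refine h.symm.trans (Finset.sum_congr rfl fun α _ => ?_)
    rw [← map_smul, smul_monomial, smul_eq_mul, mul_one]
  conv_lhs => rw [sum_coeff_rowHom_mul f]
  rw [← hB]
  calc _ = ∑ β ∈ B, ∑ α ∈ (colHom k σ τ f).support,
        rename Sum.inl (p β.degree (monomial α 1)) *
          rename Sum.inr (monomial β (coeff α (coeff β (rowHom k σ τ f)))) := by
        refine Finset.sum_congr rfl fun β _ => ?_
        conv_lhs => rw [h1 β]
        rw [map_sum, Finset.sum_mul]
        refine Finset.sum_congr rfl fun α _ => ?_
        rw [map_smul, smul_mul_assoc, ← mul_smul_comm, ← map_smul, smul_monomial, smul_eq_mul,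
          mul_one]
    _ = _ := by
        rw [Finset.sum_comm]
        refine Finset.sum_congr rfl fun α _ => ?_
        rw [← Finset.sum_fiberwise_of_maps_to
          (fun β hβ => Finset.mem_image_of_mem Finsupp.degree hβ)]
        refine Finset.sum_congr rfl fun d _ => ?_
        rw [← sum_monomial_degree_eq, map_sum, Finset.mul_sum]
        refine Finset.sum_congr rfl fun β hβ => ?_
        rw [(Finset.mem_filter.1 hβ).2]

theorem mem_iSup_of_coeff_mem {V : ℕ → Ideal (MvPolynomial σ k)}
    {W : ℕ → Ideal (MvPolynomial τ k)} (hV : ∀ i, IsHomogIdeal (V i))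
    (hW : ∀ i, IsHomogIdeal (W i)) {s : ℕ} {f : MvPolynomial (σ ⊕ τ) k}
    (hfV : ∀ β, coeff β (rowHom k σ τ f) ∈ V (s - β.degree))
    (hfW : ∀ α, coeff α (colHom k σ τ f) ∈ W (s - α.degree)) :
    f ∈ ⨆ i ∈ Finset.range (s + 1), ⨆ t ∈ Finset.range (s + 1),
        (Ideal.map (rename Sum.inl : MvPolynomial σ k →ₐ[k] MvPolynomial (σ ⊕ τ) k) (V i) ⊓
          Ideal.map (rename Sum.inl : MvPolynomial σ k →ₐ[k] MvPolynomial (σ ⊕ τ) k)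
            (mxI k σ) ^ (s - t)) *
        (Ideal.map (rename Sum.inr : MvPolynomial τ k →ₐ[k] MvPolynomial (σ ⊕ τ) k) (W t) ⊓
          Ideal.map (rename Sum.inr : MvPolynomial τ k →ₐ[k] MvPolynomial (σ ⊕ τ) k)
            (mxI k τ) ^ (s - i)) := by
  choose p hpV hp using fun d => (hV (s - d)).exists_projection
  rw [eq_sum_projection_mul p (fun β => hpV _ _ (hfV β))]
  refine Ideal.sum_mem _ fun α _ => Ideal.sum_mem _ fun d _ => ?_
  refine Submodule.mem_iSup_of_mem (s - d) (Submodule.mem_iSup_of_mem (by simp)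
    (Submodule.mem_iSup_of_mem (s - α.degree) (Submodule.mem_iSup_of_mem (by simp)
    (Ideal.mul_mem_mul ⟨?_, ?_⟩ ⟨?_, ?_⟩))))
  · exact Ideal.mem_map_of_mem _ (hp d α).1
  · rw [← Ideal.map_pow]
    exact Ideal.mem_map_of_mem _
      (Ideal.pow_le_pow_right (by omega) (mem_mxI_pow_of_isHomogeneous (hp d α).2))
  · exact Ideal.mem_map_of_mem _ (hW _ _ (hfW α) d)
  · rw [← Ideal.map_pow]
    exact Ideal.mem_map_of_mem _ (Ideal.pow_le_pow_right (by omega)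
      (mem_mxI_pow_of_isHomogeneous (homogeneousComponent_isHomogeneous d _)))

theorem constantCoeff_colHom_rename_inl {r : MvPolynomial σ k} (hr : r ∈ mxI k σ) :
    constantCoeff (colHom k σ τ (rename Sum.inl r)) = 0 := by
  rw [mxI_eq_ker, RingHom.mem_ker, constantCoeff_eq] at hr
  rw [colHom_rename_inl, constantCoeff_eq, coeff_map, hr, map_zero]

theorem sub_rename_inr_mem_mul {h : MvPolynomial (σ ⊕ τ) k}
    (hh : h ∈ (mxI k τ).map (rename Sum.inr : MvPolynomial τ k →ₐ[k] MvPolynomial (σ ⊕ τ) k)) :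
    h - rename Sum.inr (constantCoeff (colHom k σ τ h)) ∈
      (mxI k σ).map (rename Sum.inl : MvPolynomial σ k →ₐ[k] MvPolynomial (σ ⊕ τ) k) *
      (mxI k τ).map (rename Sum.inr : MvPolynomial τ k →ₐ[k] MvPolynomial (σ ⊕ τ) k) := by
  refine Submodule.span_induction (fun y hy => ?_) (by simp) (fun y z _ _ hy hz => ?_)
    (fun t y hyN hy => ?_) hh
  · obtain ⟨z, -, rfl⟩ := hy
    simp [colHom_rename_inr]
  · simp only [map_add]
    convert Ideal.add_mem _ hy hz using 1
    ring
  · have h := Ideal.add_mem _ (Ideal.mul_mem_mul (sub_rename_inr_mem t) hyN)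
      (Ideal.mul_mem_left _ (rename Sum.inr (constantCoeff (colHom k σ τ t))) hy)
    rwa [sub_mul, mul_sub, sub_add_sub_cancel, ← map_mul, ← map_mul, ← map_mul] at h

theorem mem_of_constantCoeff_mem {I : Ideal (MvPolynomial σ k)} {J : Ideal (MvPolynomial τ k)}
    (hI : I ≤ mxI k σ) {h : MvPolynomial (σ ⊕ τ) k}
    (hhI : constantCoeff (rowHom k σ τ h) ∈ I) (hhJ : constantCoeff (colHom k σ τ h) ∈ J) :
    h ∈ I.map (rename Sum.inl : MvPolynomial σ k →ₐ[k] MvPolynomial (σ ⊕ τ) k) +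
      J.map (rename Sum.inr : MvPolynomial τ k →ₐ[k] MvPolynomial (σ ⊕ τ) k) +
      (mxI k σ).map (rename Sum.inl : MvPolynomial σ k →ₐ[k] MvPolynomial (σ ⊕ τ) k) *
      (mxI k τ).map (rename Sum.inr : MvPolynomial τ k →ₐ[k] MvPolynomial (σ ⊕ τ) k) := by
  have h1 := sub_rename_inr_mem_mul (sub_rename_inl_mem h)
  rw [map_sub, map_sub, constantCoeff_colHom_rename_inl (hI hhI), sub_zero] at h1
  have h2 := Submodule.add_mem_sup (Submodule.add_mem_sup
    (Ideal.mem_map_of_mem (rename Sum.inl : MvPolynomial σ k →ₐ[k] MvPolynomial (σ ⊕ τ) k) hhI)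
    (Ideal.mem_map_of_mem (rename Sum.inr : MvPolynomial τ k →ₐ[k] MvPolynomial (σ ⊕ τ) k) hhJ)) h1
  rwa [sub_sub, add_sub_cancel] at h2

theorem map_mxI_le_comap_rowHom :
    (mxI k τ).map (rename Sum.inr : MvPolynomial τ k →ₐ[k] MvPolynomial (σ ⊕ τ) k) ≤
      (Ideal.span (Set.range X)).comap (rowHom k σ τ) := by
  rw [mxI, Ideal.map_span, Ideal.span_le]
  rintro _ ⟨_, ⟨j, rfl⟩, rfl⟩
  rw [SetLike.mem_coe, Ideal.mem_comap, rename_X, rowHom, aeval_X]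
  exact Ideal.subset_span ⟨j, rfl⟩

theorem map_mxI_le_comap_colHom :
    (mxI k σ).map (rename Sum.inl : MvPolynomial σ k →ₐ[k] MvPolynomial (σ ⊕ τ) k) ≤
      (Ideal.span (Set.range X)).comap (colHom k σ τ) := by
  rw [mxI, Ideal.map_span, Ideal.span_le]
  rintro _ ⟨_, ⟨j, rfl⟩, rfl⟩
  rw [SetLike.mem_coe, Ideal.mem_comap, rename_X, colHom, aeval_X]
  exact Ideal.subset_span ⟨j, rfl⟩

theorem fiberProduct_le_comap_rowHom {I : Ideal (MvPolynomial σ k)} {J : Ideal (MvPolynomial τ k)}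
    (hJ : J ≤ mxI k τ) :
    I.map (rename Sum.inl : MvPolynomial σ k →ₐ[k] MvPolynomial (σ ⊕ τ) k) +
      J.map (rename Sum.inr : MvPolynomial τ k →ₐ[k] MvPolynomial (σ ⊕ τ) k) +
      (mxI k σ).map (rename Sum.inl : MvPolynomial σ k →ₐ[k] MvPolynomial (σ ⊕ τ) k) *
      (mxI k τ).map (rename Sum.inr : MvPolynomial τ k →ₐ[k] MvPolynomial (σ ⊕ τ) k) ≤
    (I.map C ⊔ Ideal.span (Set.range X)).comap (rowHom k σ τ) := by
  have hN := map_mxI_le_comap_rowHom.trans (Ideal.comap_mono (f := rowHom k σ τ)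
    (le_sup_right : Ideal.span (Set.range X) ≤ I.map C ⊔ Ideal.span (Set.range X)))
  refine sup_le (sup_le (Ideal.map_le_iff_le_comap.2 fun r hr => ?_) ((Ideal.map_mono hJ).trans hN))
    (Ideal.mul_le_right.trans hN)
  rw [Ideal.mem_comap, Ideal.mem_comap, rowHom_rename_inl]
  exact Ideal.mem_sup_left (Ideal.mem_map_of_mem _ hr)

theorem fiberProduct_le_comap_colHom {I : Ideal (MvPolynomial σ k)} {J : Ideal (MvPolynomial τ k)}
    (hI : I ≤ mxI k σ) :
    I.map (rename Sum.inl : MvPolynomial σ k →ₐ[k] MvPolynomial (σ ⊕ τ) k) +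
      J.map (rename Sum.inr : MvPolynomial τ k →ₐ[k] MvPolynomial (σ ⊕ τ) k) +
      (mxI k σ).map (rename Sum.inl : MvPolynomial σ k →ₐ[k] MvPolynomial (σ ⊕ τ) k) *
      (mxI k τ).map (rename Sum.inr : MvPolynomial τ k →ₐ[k] MvPolynomial (σ ⊕ τ) k) ≤
    (J.map C ⊔ Ideal.span (Set.range X)).comap (colHom k σ τ) := by
  have hM := map_mxI_le_comap_colHom.trans (Ideal.comap_mono (f := colHom k σ τ)
    (le_sup_right : Ideal.span (Set.range X) ≤ J.map C ⊔ Ideal.span (Set.range X)))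
  refine sup_le (sup_le ((Ideal.map_mono hI).trans hM) (Ideal.map_le_iff_le_comap.2 fun r hr => ?_))
    (Ideal.mul_le_left.trans hM)
  rw [Ideal.mem_comap, Ideal.mem_comap, colHom_rename_inr]
  exact Ideal.mem_sup_left (Ideal.mem_map_of_mem _ hr)

end FiberProduct

theorem symbPow_fiberProduct_eq_sum
    (k : Type*) [Field k] (a b : ℕ) (ha : 0 < a) (hb : 0 < b)
    (I : Ideal (MvPolynomial (Fin a) k)) (hIm : I ≤ mxI k (Fin a) ^ 2)
    (hIproper : I ≠ ⊤) (hIhom : IsHomogIdeal I)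
    (J : Ideal (MvPolynomial (Fin b) k)) (hJn : J ≤ mxI k (Fin b) ^ 2)
    (hJproper : J ≠ ⊤) (hJhom : IsHomogIdeal J)
    -- `depth(R/I) ≥ 1` and `depth(S/J) ≥ 1`, equivalently the graded maximal ideals are
    -- not associated primes of `R/I` and `S/J` respectively
    (hdepthI : mxI k (Fin a) ∉
      associatedPrimes (MvPolynomial (Fin a) k) (MvPolynomial (Fin a) k ⧸ I))
    (hdepthJ : mxI k (Fin b) ∉
      associatedPrimes (MvPolynomial (Fin b) k) (MvPolynomial (Fin b) k ⧸ J))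
    (I' J' m' n' : Ideal (MvPolynomial (Fin a ⊕ Fin b) k))
    (hI' : I' = Ideal.map (rename (Sum.inl : Fin a → Fin a ⊕ Fin b) :
      MvPolynomial (Fin a) k →ₐ[k] MvPolynomial (Fin a ⊕ Fin b) k) I)
    (hJ' : J' = Ideal.map (rename (Sum.inr : Fin b → Fin a ⊕ Fin b) :
      MvPolynomial (Fin b) k →ₐ[k] MvPolynomial (Fin a ⊕ Fin b) k) J)
    (hm' : m' = Ideal.map (rename (Sum.inl : Fin a → Fin a ⊕ Fin b) :
      MvPolynomial (Fin a) k →ₐ[k] MvPolynomial (Fin a ⊕ Fin b) k) (mxI k (Fin a)))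
    (hn' : n' = Ideal.map (rename (Sum.inr : Fin b → Fin a ⊕ Fin b) :
      MvPolynomial (Fin b) k →ₐ[k] MvPolynomial (Fin a ⊕ Fin b) k) (mxI k (Fin b)))
    (F : Ideal (MvPolynomial (Fin a ⊕ Fin b) k)) (hF : F = I' + J' + m' * n')
    (s : ℕ) (hs : 1 ≤ s) :
    symbPow F s =
      ⨆ i ∈ Finset.range (s + 1), ⨆ t ∈ Finset.range (s + 1),
        (Ideal.map (rename (Sum.inl : Fin a → Fin a ⊕ Fin b) :
            MvPolynomial (Fin a) k →ₐ[k] MvPolynomial (Fin a ⊕ Fin b) k) (symbPow I i) ⊓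
          m' ^ (s - t)) *
        (Ideal.map (rename (Sum.inr : Fin b → Fin a ⊕ Fin b) :
            MvPolynomial (Fin b) k →ₐ[k] MvPolynomial (Fin a ⊕ Fin b) k) (symbPow J t) ⊓
          n' ^ (s - i)) := by
  subst hI' hJ' hm' hn'
  set ι := (rename Sum.inl : MvPolynomial (Fin a) k →ₐ[k] MvPolynomial (Fin a ⊕ Fin b) k)
  set κ := (rename Sum.inr : MvPolynomial (Fin b) k →ₐ[k] MvPolynomial (Fin a ⊕ Fin b) k)
  have hIle : I ≤ mxI k (Fin a) := hIm.trans (Ideal.pow_le_self two_ne_zero)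
  have hJle : J ≤ mxI k (Fin b) := hJn.trans (Ideal.pow_le_self two_ne_zero)
  let ρ := (rowHom k (Fin a) (Fin b)).toRingHom
  let γ := (colHom k (Fin a) (Fin b)).toRingHom
  have hρι : ∀ r, ρ (ι.toRingHom r) = C r := rowHom_rename_inl
  have hγκ : ∀ r, γ (κ.toRingHom r) = C r := colHom_rename_inr
  have hIF : I.map ι.toRingHom ≤ F := hF ▸ le_sup_left.trans le_sup_left
  have hJF : J.map κ.toRingHom ≤ F := hF ▸ le_sup_right.trans le_sup_left
  have hmn : (mxI k (Fin a)).map ι.toRingHom * (mxI k (Fin b)).map κ ≤ F := hF ▸ le_sup_right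
  have hnm : (mxI k (Fin b)).map κ.toRingHom * (mxI k (Fin a)).map ι ≤ F :=
    (mul_comm _ _).trans_le hmn
  have hFρ : F ≤ (I.map C ⊔ Ideal.span (Set.range X)).comap ρ :=
    hF ▸ fiberProduct_le_comap_rowHom hJle
  have hFγ : F ≤ (J.map C ⊔ Ideal.span (Set.range X)).comap γ :=
    hF ▸ fiberProduct_le_comap_colHom hIle
  have hρι' : ∀ r, constantCoeff.comp ρ (ι.toRingHom r) = r := fun r => by
    rw [RingHom.comp_apply, hρι, constantCoeff_C]
  have hγκ' : ∀ r, constantCoeff.comp γ (κ.toRingHom r) = r := fun r => by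
    rw [RingHom.comp_apply, hγκ, constantCoeff_C]
  refine le_antisymm (fun f hf => ?_) ?_
  · exact mem_iSup_of_coeff_mem hIhom.symbPow hJhom.symbPow
      (coeff_mem_symbPow_of_mem_symbPow hρι sub_rename_inl_mem hmn hIF hFρ isMaximal_mxI hdepthI hf)
      (coeff_mem_symbPow_of_mem_symbPow hγκ sub_rename_inr_mem hnm hJF hFγ isMaximal_mxI hdepthJ hf)
  · refine iSup₂_le fun i _ => iSup₂_le fun t _ => fun f hf => mem_symbPow.2 fun Q hQ => ?_
    have hQp : Q.IsPrime := IsAssociatedPrime.isPrime hQ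
    obtain ⟨-, g, hg⟩ := mem_associatedPrimes_quotient_iff.1 hQ
    have hFQ : F ≤ Q := fun y hy => (hg y).2 (Ideal.mul_mem_right _ _ hy)
    have hor : ¬ ((mxI k (Fin a)).map ι ≤ Q ∧ (mxI k (Fin b)).map κ ≤ Q) := by
      rintro ⟨hM, hN⟩
      have h1 := apply_mem_of_forall_mul_mem hρι' (le_comap_constantCoeff_comp hFρ)
        isMaximal_mxI hdepthI (h := g) fun y hy => (hg y).1 (hM hy)
      have h2 := apply_mem_of_forall_mul_mem hγκ' (le_comap_constantCoeff_comp hFγ)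
        isMaximal_mxI hdepthJ (h := g) fun y hy => (hg y).1 (hN hy)
      refine hQp.one_notMem ((hg 1).2 ?_)
      rw [one_mul, hF]
      exact mem_of_constantCoeff_mem hIle h1 h2
    rcases hQp.mul_le.1 (hmn.trans hFQ) with hM | hN
    · obtain ⟨P, hP, rfl, hnP⟩ := exists_eq_comap_of_mem_associatedPrimes hγκ'
        sub_rename_inr_mem hnm hJF (le_comap_constantCoeff_comp hFγ) hQ hM fun h => hor ⟨hM, h⟩
      refine mem_contraction.1 (map_symbPow_mul_pow_le_contraction hγκ' hnm hJF hP hnP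
        (i := t) (j := s - t) (by omega) ?_)
      rw [mul_comm]
      exact Ideal.mul_mono inf_le_right inf_le_left hf
    · obtain ⟨P, hP, rfl, hmP⟩ := exists_eq_comap_of_mem_associatedPrimes hρι'
        sub_rename_inl_mem hmn hIF (le_comap_constantCoeff_comp hFρ) hQ hN fun h => hor ⟨h, hN⟩
      exact mem_contraction.1 (map_symbPow_mul_pow_le_contraction hρι' hmn hIF hP hmP
        (i := i) (j := s - i) (by omega) (Ideal.mul_mono inf_le_left inf_le_right hf))

end
end

section
/- Let k be a field, let R and S be polynomial rings over k in at least one variable each, with graded maximal ideals m and n, let I ⊆ m² and J ⊆ n² be proper homogeneous ideals, let T = R ⊗_k S, and let F = I + J + mn ⊆ T. If depth(R/I) ≥ 1 and depth(S/J) ≥ 1, then for every integer s ≥ 1 one has depth(T/F^{(s)}) = 1. -/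
/- STATEMENT 14: k a field, R and S polynomial rings over k in at least one variable each
with graded maximal ideals m and n, I ⊆ m² and J ⊆ n² proper homogeneous ideals,
T = R ⊗_k S, F = I + J + mn. If depth(R/I) ≥ 1 and depth(S/J) ≥ 1, then for every s ≥ 1:
depth(T/F^{(s)}) = 1. -/

open MvPolynomial

noncomputable section

/-- Depth of a module `M` with respect to an ideal `p`: the supremum of the lengths of
`M`-regular sequences consisting of elements of `p`. -/
def seqDepth {A : Type*} [CommRing A] (p : Ideal A) (M : Type*) [AddCommGroup M]
    [Module A M] : ℕ :=
  sSup {l : ℕ | ∃ rs : List A, rs.length = l ∧ (∀ r ∈ rs, r ∈ p) ∧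
    RingTheory.Sequence.IsRegular M rs}

section CommutativeAlgebra

variable {A : Type*} [CommRing A]

lemma isSMulRegular_quotient_iff_mul {a : Ideal A} {h : A} :
    IsSMulRegular (A ⧸ a) h ↔ ∀ t, h * t ∈ a → t ∈ a :=
  isSMulRegular_quotient_iff_mem_of_smul_mem a h

/-- Over a noetherian ring, an element not lying in any associated prime of `a` is the same as
a nonzerodivisor modulo `a`. -/
lemma isSMulRegular_iff_forall_associatedPrimes [IsNoetherianRing A] {a : Ideal A} {h : A} :
    IsSMulRegular (A ⧸ a) h ↔ ∀ P ∈ associatedPrimes A (A ⧸ a), h ∉ P := by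
  have key := Set.ext_iff.mp (biUnion_associatedPrimes_eq_zero_divisors A (A ⧸ a)) h
  simp only [Set.mem_iUnion, SetLike.mem_coe, exists_prop, Set.mem_ofPred_eq] at key
  rw [isSMulRegular_iff_right_eq_zero_of_smul]
  grind

/-- Over a noetherian ring, `f` lies in the `s`-th symbolic power of `a` if and only if some
nonzerodivisor modulo `a` multiplies `f` into `a ^ s`. -/
lemma mem_symbPow_iff [IsNoetherianRing A] {a : Ideal A} {s : ℕ} {f : A} :
    f ∈ symbPow a s ↔ ∃ h, IsSMulRegular (A ⧸ a) h ∧ h * f ∈ a ^ s := by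
  have local_iff (P : Ideal A) [P.IsPrime] :
      f ∈ (Ideal.map (algebraMap A (Localization.AtPrime P)) (a ^ s)).comap
        (algebraMap A (Localization.AtPrime P)) ↔ ∃ h ∉ P, h * f ∈ a ^ s := by
    rw [Ideal.mem_comap, IsLocalization.algebraMap_mem_map_algebraMap_iff P.primeCompl]
    rfl
  simp only [symbPow, Submodule.mem_sInf, Set.mem_ofPred_eq, forall_exists_index]
  constructor
  · intro H
    let C : Ideal A := Submodule.comap (LinearMap.toSpanSingleton A A f) (a ^ s)
    have hC : ¬ (C : Set A) ⊆ ⋃ P ∈ associatedPrimes A (A ⧸ a), (P : Set A) := by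
      intro hsub
      obtain ⟨P, hP, hCP⟩ := (C.subset_union_prime_finite
        (associatedPrimes.finite A (A ⧸ a)) (f := id) 0 0 fun _ h _ _ ↦ h.isPrime).1 hsub
      have := IsAssociatedPrime.isPrime hP
      obtain ⟨h, hhP, hh⟩ := (local_iff P).1 (H _ P hP rfl)
      exact hhP (hCP hh)
    obtain ⟨h, hhC, hh⟩ := Set.not_subset.1 hC
    refine ⟨h, isSMulRegular_iff_forall_associatedPrimes.2 fun P hP hhP ↦ hh ?_, hhC⟩
    exact Set.mem_biUnion hP hhP
  · rintro ⟨h, hreg, hh⟩ _ P hP rfl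
    have := IsAssociatedPrime.isPrime hP
    exact (local_iff P).2 ⟨h, isSMulRegular_iff_forall_associatedPrimes.1 hreg P hP, hh⟩

lemma pow_le_symbPow [IsNoetherianRing A] (a : Ideal A) (s : ℕ) : a ^ s ≤ symbPow a s :=
  fun f hf ↦ mem_symbPow_iff.2 ⟨1, IsSMulRegular.one _, by simpa⟩

lemma symbPow_le [IsNoetherianRing A] (a : Ideal A) {s : ℕ} (hs : 1 ≤ s) : symbPow a s ≤ a := by
  intro f hf
  obtain ⟨h, hreg, hh⟩ := mem_symbPow_iff.1 hf
  exact isSMulRegular_quotient_iff_mul.1 hreg f (Ideal.pow_le_self (by lia) hh)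

lemma IsSMulRegular.quotient_symbPow [IsNoetherianRing A] {a : Ideal A} {z : A}
    (hz : IsSMulRegular (A ⧸ a) z) (s : ℕ) : IsSMulRegular (A ⧸ symbPow a s) z := by
  refine isSMulRegular_quotient_iff_mul.2 fun f hf ↦ ?_
  obtain ⟨h, hreg, hh⟩ := mem_symbPow_iff.1 hf
  exact mem_symbPow_iff.2 ⟨h * z, hreg.mul hz, by rwa [mul_assoc]⟩

lemma mul_pow_le_inf_pow {P Q : Ideal A} {x : A} (hx : x ∈ Q) (s : ℕ) {f : A}
    (hf : f ∈ P ^ s) : x ^ s * f ∈ (P ⊓ Q) ^ s := by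
  refine Ideal.pow_right_mono (Ideal.mul_le_inf.trans (inf_comm Q P).le) s ?_
  rw [mul_pow]
  exact Ideal.mul_mem_mul (Ideal.pow_mem_pow hx s) hf

lemma isSMulRegular_add_quotient_inf {P Q : Ideal A} {x y : A} (hxQ : x ∈ Q) (hyP : y ∈ P)
    (hx : IsSMulRegular (A ⧸ P) x) (hy : IsSMulRegular (A ⧸ Q) y) :
    IsSMulRegular (A ⧸ (P ⊓ Q)) (x + y) := by
  rw [isSMulRegular_quotient_iff_mul] at *
  rintro t ⟨hP, hQ⟩
  refine ⟨hx t ?_, hy t ?_⟩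
  · rw [add_mul] at hP
    exact (Ideal.add_mem_iff_left P (P.mul_mem_right t hyP)).1 hP
  · rw [add_mul] at hQ
    exact (Ideal.add_mem_iff_right Q (Q.mul_mem_right t hxQ)).1 hQ

lemma symbPow_inf_le_left [IsNoetherianRing A] {P Q : Ideal A} {x : A} (hxQ : x ∈ Q)
    (hx : IsSMulRegular (A ⧸ P) x) (s : ℕ) : symbPow (P ⊓ Q) s ≤ symbPow P s := by
  intro f hf
  obtain ⟨h, hreg, hh⟩ := mem_symbPow_iff.1 hf
  refine mem_symbPow_iff.2 ⟨h, ?_, Ideal.pow_right_mono inf_le_left s hh⟩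
  rw [isSMulRegular_quotient_iff_mul] at *
  intro t ht
  refine hx t (hreg (x * t) ?_).1
  rw [mul_left_comm]
  exact ⟨P.mul_mem_left x ht, Q.mul_mem_right _ hxQ⟩

/-- Symbolic powers commute with an intersection `P ⊓ Q` when each of the two ideals contains a
nonzerodivisor modulo the other. -/
lemma symbPow_inf [IsNoetherianRing A] {P Q : Ideal A} {x y : A} (hxQ : x ∈ Q) (hyP : y ∈ P)
    (hx : IsSMulRegular (A ⧸ P) x) (hy : IsSMulRegular (A ⧸ Q) y) (s : ℕ) :
    symbPow (P ⊓ Q) s = symbPow P s ⊓ symbPow Q s := by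
  refine le_antisymm (le_inf (symbPow_inf_le_left hxQ hx s) ?_) ?_
  · rw [inf_comm]
    exact symbPow_inf_le_left hyP hy s
  rintro f ⟨hfP, hfQ⟩
  obtain ⟨g, hg, hgf⟩ := mem_symbPow_iff.1 hfP
  obtain ⟨g', hg', hgf'⟩ := mem_symbPow_iff.1 hfQ
  refine mem_symbPow_iff.2 ⟨x * (x ^ s * g) + y * (y ^ s * g'), ?_, ?_⟩
  · exact isSMulRegular_add_quotient_inf (Q.mul_mem_right _ hxQ) (P.mul_mem_right _ hyP)
      (hx.mul ((hx.pow s).mul hg)) (hy.mul ((hy.pow s).mul hg'))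
  · rw [add_mul, mul_assoc, mul_assoc, mul_assoc, mul_assoc]
    refine add_mem (Ideal.mul_mem_left _ _ (mul_pow_le_inf_pow hxQ s hgf))
      (Ideal.mul_mem_left _ _ ?_)
    rw [inf_comm]
    exact mul_pow_le_inf_pow hyP s hgf'

lemma exists_notMem_forall_mul_mem_of_pow_le {M C : Ideal A} {N : ℕ} (hN : M ^ N ≤ C)
    (hC : C ≠ ⊤) : ∃ u ∉ C, ∀ z ∈ M, z * u ∈ C := by
  classical
  have hex : ∃ n, M ^ n ≤ C := ⟨N, hN⟩
  have hpos : Nat.find hex ≠ 0 := by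
    intro h0
    have := Nat.find_spec hex
    rw [h0, pow_zero, Ideal.one_eq_top, top_le_iff] at this
    exact hC this
  obtain ⟨n, hn⟩ := Nat.exists_eq_succ_of_ne_zero hpos
  obtain ⟨u, hu, huC⟩ := SetLike.not_le_iff_exists.1 (Nat.find_min hex (m := n) (by lia))
  refine ⟨u, huC, fun z hz ↦ ?_⟩
  have := Nat.find_spec hex
  rw [hn, Nat.succ_eq_add_one, pow_succ'] at this
  exact this (Ideal.mul_mem_mul hz hu)

lemma isSMulRegular_quotient_of_inf {B C : Ideal A} {x z : A} (hxC : x ∈ C)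
    (hx : IsSMulRegular (A ⧸ B) x) (hz : IsSMulRegular (A ⧸ (B ⊓ C)) z) :
    IsSMulRegular (A ⧸ B) z := by
  rw [isSMulRegular_quotient_iff_mul] at *
  intro t ht
  refine hx t (hz (x * t) ?_).1
  rw [mul_left_comm]
  exact ⟨B.mul_mem_left x ht, C.mul_mem_right _ hxC⟩

open scoped Pointwise in
lemma mem_sup_span_of_isSMulRegular_quotSMulTop {C : Ideal A} {z w t : A}
    (hw : IsSMulRegular (QuotSMulTop z (A ⧸ C)) w) (ht : w * t ∈ C ⊔ Ideal.span {z}) :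
    t ∈ C ⊔ Ideal.span {z} := by
  have mem_iff (r : A) : (Ideal.Quotient.mk C r) ∈ (z • (⊤ : Submodule A (A ⧸ C))) ↔
      r ∈ C ⊔ Ideal.span {z} := by
    rw [Submodule.mem_smul_pointwise_iff_exists, Submodule.mem_sup]
    constructor
    · rintro ⟨q, -, hq⟩
      obtain ⟨q, rfl⟩ := Ideal.Quotient.mk_surjective q
      have : z * q - r ∈ C := Ideal.Quotient.eq.1 hq
      exact ⟨r - z * q, by simpa using neg_mem this, z * q,
        Ideal.mul_mem_right _ _ (Ideal.mem_span_singleton_self z), by ring⟩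
    · rintro ⟨c, hc, v, hv, rfl⟩
      obtain ⟨q, rfl⟩ := Ideal.mem_span_singleton'.1 hv
      refine ⟨Ideal.Quotient.mk C q, trivial, Ideal.Quotient.eq.2 ?_⟩
      have : z * q - (c + q * z) = -c := by ring
      simpa [this] using hc
  rw [← mem_iff] at ht ⊢
  exact (isSMulRegular_quotient_iff_mem_of_smul_mem _ w).1 hw _ ht

/-- If `A ⧸ (B ⊔ C)` has a nonzero element killed by `M`, and each of `B`, `C` contains a
nonzerodivisor modulo the other, then regular sequences in `M` on `A ⧸ (B ⊓ C)` have length at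
most one. -/
lemma length_le_one_of_isWeaklyRegular_quotient_inf {B C M : Ideal A} {x y u : A}
    (hxC : x ∈ C) (hyB : y ∈ B) (hx : IsSMulRegular (A ⧸ B) x) (hy : IsSMulRegular (A ⧸ C) y)
    (hu : u ∉ B ⊔ C) (hMu : ∀ z ∈ M, z * u ∈ B ⊔ C) {rs : List A} (hrs : ∀ r ∈ rs, r ∈ M)
    (hreg : RingTheory.Sequence.IsWeaklyRegular (A ⧸ (B ⊓ C)) rs) : rs.length ≤ 1 := by
  match rs with
  | [] => simp
  | [_] => simp
  | z :: w :: rs =>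
    exfalso
    rw [RingTheory.Sequence.isWeaklyRegular_cons_iff,
      RingTheory.Sequence.isWeaklyRegular_cons_iff] at hreg
    obtain ⟨hz, hw, -⟩ := hreg
    have hzB := isSMulRegular_quotient_iff_mul.1
      (isSMulRegular_quotient_of_inf hxC hx hz)
    have hzC := isSMulRegular_quotient_iff_mul.1
      (isSMulRegular_quotient_of_inf hyB hy (by rwa [inf_comm]))
    obtain ⟨β, hβ, γ, hγ, hzu⟩ := Submodule.mem_sup.1 (hMu z (hrs z (by simp)))
    obtain ⟨β', hβ', γ', hγ', hwu⟩ := Submodule.mem_sup.1 (hMu w (hrs w (by simp)))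
    have hmem : w * β - z * β' ∈ B ⊓ C := by
      refine ⟨sub_mem (B.mul_mem_left _ hβ) (B.mul_mem_left _ hβ'), ?_⟩
      have : w * β - z * β' = z * γ' - w * γ := by linear_combination w * hzu - z * hwu
      rw [this]
      exact sub_mem (C.mul_mem_left _ hγ') (C.mul_mem_left _ hγ)
    have hβmem : β ∈ (B ⊓ C) ⊔ Ideal.span {z} := by
      refine mem_sup_span_of_isSMulRegular_quotSMulTop hw ?_
      rw [← sub_add_cancel (w * β) (z * β')]
      exact add_mem (Ideal.mem_sup_left hmem) (Ideal.mem_sup_right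
        (Ideal.mul_mem_right _ _ (Ideal.mem_span_singleton_self z)))
    obtain ⟨c, ⟨hcB, hcC⟩, v, hv, hcv⟩ := Submodule.mem_sup.1 hβmem
    obtain ⟨t, rfl⟩ := Ideal.mem_span_singleton'.1 hv
    have htB : t ∈ B := by
      refine hzB t ?_
      have : z * t = β - c := by linear_combination hcv
      rw [this]
      exact sub_mem hβ hcB
    have huC : u - t ∈ C := by
      refine hzC _ ?_
      have : z * (u - t) = c + γ := by linear_combination -hzu - hcv
      rw [this]
      exact add_mem hcC hγ
    refine hu ?_
    rw [← add_sub_cancel t u]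
    exact add_mem (Ideal.mem_sup_left htB) (Ideal.mem_sup_right huC)

lemma exists_mem_isSMulRegular_of_one_le_seqDepth {p : Ideal A} {M : Type*} [AddCommGroup M]
    [Module A M] (h : 1 ≤ seqDepth p M) : ∃ x ∈ p, IsSMulRegular M x := by
  have hmem := Nat.sSup_mem (s := {l : ℕ | ∃ rs : List A, rs.length = l ∧ (∀ r ∈ rs, r ∈ p) ∧
    RingTheory.Sequence.IsRegular M rs})
    (Set.nonempty_iff_ne_empty.2 fun h0 ↦ by simp [seqDepth, h0] at h)
    (by by_contra hb; simp [seqDepth, Nat.sSup_of_not_bddAbove hb] at h)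
  obtain ⟨rs, hlen, hrs, hreg⟩ := hmem
  change rs.length = seqDepth p M at hlen
  match rs with
  | [] => simp at hlen; lia
  | x :: rs =>
    exact ⟨x, hrs x (by simp), ((RingTheory.Sequence.isRegular_cons_iff M x rs).1 hreg).1⟩

/-- The depth of `A ⧸ (P ⊓ Q)^{(s)}` is one when each of `P`, `Q` contains a nonzerodivisor modulo
the other and `M = P + Q` is proper. -/
lemma seqDepth_quotient_symbPow_inf [IsNoetherianRing A] {P Q M : Ideal A} {x y : A}
    (hxQ : x ∈ Q) (hyP : y ∈ P) (hx : IsSMulRegular (A ⧸ P) x) (hy : IsSMulRegular (A ⧸ Q) y)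
    (hPM : P ⊔ Q = M) (hM : M ≠ ⊤) {s : ℕ} (hs : 1 ≤ s) :
    seqDepth M (A ⧸ symbPow (P ⊓ Q) s) = 1 := by
  have hle : symbPow P s ⊔ symbPow Q s ≤ M :=
    (sup_le_sup (symbPow_le P hs) (symbPow_le Q hs)).trans hPM.le
  have hpow : M ^ (s + s) ≤ symbPow P s ⊔ symbPow Q s := by
    rw [← hPM]
    exact Ideal.sup_pow_add_le_pow_sup_pow.trans
      (sup_le_sup (pow_le_symbPow P s) (pow_le_symbPow Q s))
  obtain ⟨u, hu, hMu⟩ := exists_notMem_forall_mul_mem_of_pow_le hpow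
    (ne_top_of_le_ne_top hM hle)
  have hbound : ∀ l ∈ {l : ℕ | ∃ rs : List A, rs.length = l ∧ (∀ r ∈ rs, r ∈ M) ∧
      RingTheory.Sequence.IsRegular (A ⧸ symbPow (P ⊓ Q) s) rs}, l ≤ 1 := by
    rintro _ ⟨rs, rfl, hrs, hreg⟩
    have hreg := hreg.toIsWeaklyRegular
    rw [symbPow_inf hxQ hyP hx hy] at hreg
    exact length_le_one_of_isWeaklyRegular_quotient_inf
      (pow_le_symbPow Q s (Ideal.pow_mem_pow hxQ s)) (pow_le_symbPow P s (Ideal.pow_mem_pow hyP s))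
      ((hx.pow s).quotient_symbPow s) ((hy.pow s).quotient_symbPow s) hu hMu hrs hreg
  refine IsGreatest.csSup_eq ⟨⟨[x + y], rfl, ?_, ?_⟩, hbound⟩
  · simp only [List.mem_singleton, forall_eq]
    rw [← hPM]
    exact add_mem (Ideal.mem_sup_right hxQ) (Ideal.mem_sup_left hyP)
  · refine ⟨(RingTheory.Sequence.isWeaklyRegular_singleton_iff _ _).2
      ((isSMulRegular_add_quotient_inf hxQ hyP hx hy).quotient_symbPow s), fun htop ↦ hM ?_⟩
    have h1 : (Ideal.Quotient.mk (symbPow (P ⊓ Q) s) 1) ∈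
        Ideal.ofList [x + y] • (⊤ : Submodule A (A ⧸ symbPow (P ⊓ Q) s)) := htop ▸ trivial
    rw [Ideal.ofList_singleton, Submodule.ideal_span_singleton_smul,
      Submodule.mem_smul_pointwise_iff_exists] at h1
    obtain ⟨q, -, hq⟩ := h1
    obtain ⟨q, rfl⟩ := Ideal.Quotient.mk_surjective q
    have hmem : (x + y) * q - 1 ∈ symbPow (P ⊓ Q) s := Ideal.Quotient.eq.1 hq
    have hmem' : (x + y) * q - 1 ∈ M :=
      hPM.le (Ideal.mem_sup_left ((symbPow_le _ hs).trans inf_le_left hmem))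
    have hxy : (x + y) * q ∈ M := M.mul_mem_right _
      (hPM.le (add_mem (Ideal.mem_sup_right hxQ) (Ideal.mem_sup_left hyP)))
    rw [Ideal.eq_top_iff_one]
    simpa using sub_mem hxy hmem'

end CommutativeAlgebra

section Polynomial

variable {k σ ρ : Type*} [Field k]

lemma mxI_ne_top : mxI k σ ≠ ⊤ := by
  rw [Ideal.ne_top_iff_one, mxI, ← Set.image_univ, mem_ideal_span_X_image]
  intro h
  obtain ⟨i, -, hi⟩ := h 0 (by simp)
  simp at hi

lemma map_rename_mxI (e : σ → ρ) :
    (mxI k σ).map (rename e : MvPolynomial σ k →ₐ[k] MvPolynomial ρ k) =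
      Ideal.span (X '' Set.range e) := by
  rw [mxI, Ideal.map_span, ← Set.range_comp, ← Set.range_comp]
  congr 2
  ext i
  simp

/-- The ideals generated by two disjoint sets of variables intersect in their product. -/
lemma span_X_inf_span_X_le_mul {s t : Set ρ} (hst : Disjoint s t) :
    Ideal.span (X '' s) ⊓ Ideal.span (X '' t) ≤
      (Ideal.span (X '' s) * Ideal.span (X '' t) : Ideal (MvPolynomial ρ k)) := by
  rintro f ⟨hs, ht⟩
  rw [SetLike.mem_coe, mem_ideal_span_X_image] at hs ht
  rw [f.as_sum]
  refine Ideal.sum_mem _ fun d hd ↦ ?_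
  obtain ⟨i, his, hi⟩ := hs d hd
  obtain ⟨j, hjt, hj⟩ := ht d hd
  have hij : i ≠ j := fun h ↦ Set.disjoint_left.1 hst his (h ▸ hjt)
  have hle : Finsupp.single i 1 + Finsupp.single j 1 ≤ d := by
    intro l
    by_cases hil : i = l <;> by_cases hjl : j = l <;> simp [hil, hjl] <;> grind
  have : monomial d (f.coeff d) = monomial (d - (Finsupp.single i 1 + Finsupp.single j 1))
      (f.coeff d) * (X i * X j) := by
    rw [X, X, monomial_mul, monomial_mul, tsub_add_cancel_of_le hle, mul_one, mul_one]
  rw [this]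
  exact Ideal.mul_mem_left _ _ (Ideal.mul_mem_mul (Ideal.subset_span ⟨i, his, rfl⟩)
    (Ideal.subset_span ⟨j, hjt, rfl⟩))

lemma sub_rename_killCompl_mem_span {e : σ → ρ} (he : e.Injective) (f : MvPolynomial ρ k) :
    f - rename e (killCompl he f) ∈ Ideal.span (X '' (Set.range e)ᶜ) := by
  rw [← Ideal.Quotient.mk_eq_mk_iff_sub_mem]
  suffices h : Ideal.Quotient.mkₐ k (Ideal.span (X '' (Set.range e)ᶜ)) =
      (Ideal.Quotient.mkₐ k (Ideal.span (X '' (Set.range e)ᶜ))).comp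
        ((rename e).comp (killCompl he)) from AlgHom.congr_fun h f
  refine algHom_ext fun i ↦ ?_
  by_cases hi : i ∈ Set.range e
  · obtain ⟨j, rfl⟩ := hi
    simp [← rename_X (R := k) e j, -rename_X]
  · have : killCompl he (X i : MvPolynomial ρ k) = 0 := by simp [killCompl, hi]
    simp only [AlgHom.comp_apply, this, map_zero]
    exact Ideal.Quotient.eq_zero_iff_mem.2 (Ideal.subset_span ⟨i, hi, rfl⟩)

lemma isSMulRegular_rename {e : σ → ρ} (he : e.Injective) {I : Ideal (MvPolynomial σ k)}
    {x : MvPolynomial σ k} (hx : IsSMulRegular (MvPolynomial σ k ⧸ I) x) :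
    IsSMulRegular (MvPolynomial ρ k ⧸ (I.map (rename e : _ →ₐ[k] MvPolynomial ρ k) ⊔
      Ideal.span (X '' (Set.range e)ᶜ))) (rename e x) := by
  rw [isSMulRegular_quotient_iff_mul] at *
  have hle : I.map (rename e : _ →ₐ[k] MvPolynomial ρ k) ⊔ Ideal.span (X '' (Set.range e)ᶜ) ≤
      I.comap (killCompl he) := by
    refine sup_le (Ideal.map_le_iff_le_comap.2 fun r hr ↦ ?_) (Ideal.span_le.2 ?_)
    · simpa [Ideal.mem_comap] using hr
    · rintro _ ⟨i, hi, rfl⟩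
      have : killCompl he (X i : MvPolynomial ρ k) = 0 := by
        simpa [killCompl] using hi
      simp [this]
  intro t ht
  have h := hle ht
  rw [Ideal.mem_comap, map_mul, killCompl_rename_app] at h
  rw [← add_sub_cancel (rename e (killCompl he t)) t]
  exact add_mem (Ideal.mem_sup_left (Ideal.mem_map_of_mem _ (hx _ h)))
    (Ideal.mem_sup_right (sub_rename_killCompl_mem_span he t))

end Polynomial

theorem depth_symbPow_fiberProduct
    (k : Type*) [Field k] (a b : ℕ) (ha : 0 < a) (hb : 0 < b)
    (I : Ideal (MvPolynomial (Fin a) k)) (hIm : I ≤ mxI k (Fin a) ^ 2)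
    (hIproper : I ≠ ⊤) (hIhom : IsHomogIdeal I)
    (J : Ideal (MvPolynomial (Fin b) k)) (hJn : J ≤ mxI k (Fin b) ^ 2)
    (hJproper : J ≠ ⊤) (hJhom : IsHomogIdeal J)
    -- `depth(R/I) ≥ 1` and `depth(S/J) ≥ 1`
    (hdepthI : 1 ≤ seqDepth (mxI k (Fin a)) (MvPolynomial (Fin a) k ⧸ I))
    (hdepthJ : 1 ≤ seqDepth (mxI k (Fin b)) (MvPolynomial (Fin b) k ⧸ J))
    (I' J' m' n' : Ideal (MvPolynomial (Fin a ⊕ Fin b) k))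
    (hI' : I' = Ideal.map (rename (Sum.inl : Fin a → Fin a ⊕ Fin b) :
      MvPolynomial (Fin a) k →ₐ[k] MvPolynomial (Fin a ⊕ Fin b) k) I)
    (hJ' : J' = Ideal.map (rename (Sum.inr : Fin b → Fin a ⊕ Fin b) :
      MvPolynomial (Fin b) k →ₐ[k] MvPolynomial (Fin a ⊕ Fin b) k) J)
    (hm' : m' = Ideal.map (rename (Sum.inl : Fin a → Fin a ⊕ Fin b) :
      MvPolynomial (Fin a) k →ₐ[k] MvPolynomial (Fin a ⊕ Fin b) k) (mxI k (Fin a)))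
    (hn' : n' = Ideal.map (rename (Sum.inr : Fin b → Fin a ⊕ Fin b) :
      MvPolynomial (Fin b) k →ₐ[k] MvPolynomial (Fin a ⊕ Fin b) k) (mxI k (Fin b)))
    (F : Ideal (MvPolynomial (Fin a ⊕ Fin b) k)) (hF : F = I' + J' + m' * n')
    (s : ℕ) (hs : 1 ≤ s) :
    seqDepth (m' + n') (MvPolynomial (Fin a ⊕ Fin b) k ⧸ symbPow F s) = 1 := by
  subst hI' hJ' hm' hn' hF
  obtain ⟨x, hxm, hx⟩ := exists_mem_isSMulRegular_of_one_le_seqDepth hdepthI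
  obtain ⟨y, hyn, hy⟩ := exists_mem_isSMulRegular_of_one_le_seqDepth hdepthJ
  have hx' := isSMulRegular_rename (Sum.inl_injective (β := Fin b)) hx
  have hy' := isSMulRegular_rename (Sum.inr_injective (α := Fin a)) hy
  rw [Set.compl_range_inl, ← map_rename_mxI] at hx'
  rw [Set.compl_range_inr, ← map_rename_mxI] at hy'
  have hxm' := Ideal.mem_map_of_mem (rename (Sum.inl : Fin a → Fin a ⊕ Fin b) :
    MvPolynomial (Fin a) k →ₐ[k] MvPolynomial (Fin a ⊕ Fin b) k) hxm
  have hyn' := Ideal.mem_map_of_mem (rename (Sum.inr : Fin b → Fin a ⊕ Fin b) :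
    MvPolynomial (Fin b) k →ₐ[k] MvPolynomial (Fin a ⊕ Fin b) k) hyn
  have hIm' := Ideal.map_mono (f := (rename (Sum.inl : Fin a → Fin a ⊕ Fin b) :
    MvPolynomial (Fin a) k →ₐ[k] MvPolynomial (Fin a ⊕ Fin b) k))
    (hIm.trans (Ideal.pow_le_self two_ne_zero))
  have hJn' := Ideal.map_mono (f := (rename (Sum.inr : Fin b → Fin a ⊕ Fin b) :
    MvPolynomial (Fin b) k →ₐ[k] MvPolynomial (Fin a ⊕ Fin b) k))
    (hJn.trans (Ideal.pow_le_self two_ne_zero))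
  have hinf := span_X_inf_span_X_le_mul (k := k)
    (Set.isCompl_range_inl_range_inr (α := Fin a) (β := Fin b)).disjoint
  have hne : Ideal.span (X '' Set.range (Sum.inl : Fin a → Fin a ⊕ Fin b)) ⊔
      Ideal.span (X '' Set.range (Sum.inr : Fin b → Fin a ⊕ Fin b)) ≠
      (⊤ : Ideal (MvPolynomial (Fin a ⊕ Fin b) k)) := by
    rw [← Ideal.span_union, ← Set.image_union, Set.range_inl_union_range_inr, Set.image_univ]
    exact mxI_ne_top
  rw [← map_rename_mxI, ← map_rename_mxI] at hinf hne
  generalize Ideal.map (rename (Sum.inl : Fin a → Fin a ⊕ Fin b) :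
    MvPolynomial (Fin a) k →ₐ[k] MvPolynomial (Fin a ⊕ Fin b) k) (mxI k (Fin a)) = m' at *
  generalize Ideal.map (rename (Sum.inr : Fin b → Fin a ⊕ Fin b) :
    MvPolynomial (Fin b) k →ₐ[k] MvPolynomial (Fin a ⊕ Fin b) k) (mxI k (Fin b)) = n' at *
  generalize Ideal.map (rename (Sum.inl : Fin a → Fin a ⊕ Fin b) :
    MvPolynomial (Fin a) k →ₐ[k] MvPolynomial (Fin a ⊕ Fin b) k) I = I' at *
  generalize Ideal.map (rename (Sum.inr : Fin b → Fin a ⊕ Fin b) :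
    MvPolynomial (Fin b) k →ₐ[k] MvPolynomial (Fin a ⊕ Fin b) k) J = J' at *
  have hF : I' + J' + m' * n' = (I' ⊔ n') ⊓ (J' ⊔ m') := by
    simp only [Submodule.add_eq_sup]
    have hI' : I' ≤ J' ⊔ m' := hIm'.trans le_sup_right
    rw [sup_inf_assoc_of_le n' hI', inf_comm n', sup_inf_assoc_of_le m' hJn', sup_assoc,
      le_antisymm hinf Ideal.mul_le_inf]
  rw [hF]
  refine seqDepth_quotient_symbPow_inf (Ideal.mem_sup_right hxm') (Ideal.mem_sup_right hyn')
    hx' hy' ?_ hne hs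
  refine le_antisymm (sup_le (sup_le (hIm'.trans le_sup_left) le_sup_right)
    (sup_le (hJn'.trans le_sup_right) le_sup_left)) ?_
  exact sup_le (le_sup_right.trans le_sup_right) (le_sup_right.trans le_sup_left)

end
end
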